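/- arXiv:0808.0177 — 2 statements merged into one kernel-verified Lean document; each statement's English description precedes it below -/
import Mathlib

section
/- Let R ⊂ R̃ = k[[t₁]] × ⋯ × k[[t_m]] be a reduced complete local one-dimensional k-algebra which is Gorenstein with m branches and genus one (δ = m). Then the conductor ideal I = Ann_R(R̃/R) equals m_{R̃}², the square of the maximal ideal (t₁) ⊕ ⋯ ⊕ (t_m) of R̃. -/
set_option synthInstance.maxHeartbeats 1000000
set_option maxHeartbeats 1000000

/-- The conductor ideal `I = Ann_R (R̃/R)`. -/
noncomputable def conductorIdeal (k : Type) [Field k] (m : ℕ)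
    (R : Subalgebra k (Fin m → PowerSeries k)) : Ideal R :=
  Module.annihilator R
    ((Fin m → PowerSeries k) ⧸
      LinearMap.range (Algebra.linearMap R (Fin m → PowerSeries k)))

/-- Nested subspaces of equal finite codimension are equal. -/
theorem Submodule.eq_of_le_of_finrank_quotient_le {k M : Type*} [Field k] [AddCommGroup M]
    [Module k M] {A B : Submodule k M} [Module.Finite k (M ⧸ A)] (h : A ≤ B)
    (hle : Module.finrank k (M ⧸ A) ≤ Module.finrank k (M ⧸ B)) : A = B := by
  have hs : Function.Surjective (Submodule.factor h) := Submodule.factor_surjective h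
  have : Module.Finite k (M ⧸ B) := Module.Finite.of_surjective _ hs
  have heq := le_antisymm hle (LinearMap.finrank_le_finrank_of_surjective hs)
  have hi := (LinearMap.injective_iff_surjective_of_finrank_eq_finrank heq).2 hs
  refine le_antisymm h fun b hb => ?_
  rw [← Submodule.Quotient.mk_eq_zero]
  apply hi
  rw [map_zero]
  exact (Submodule.Quotient.mk_eq_zero B).2 hb

/-- Codimension is additive along `A ≤ B ≤ M`. -/
theorem Submodule.finite_and_finrank_quotient_of_le {k M : Type*} [Field k] [AddCommGroup M]
    [Module k M] {A B : Submodule k M} (h : A ≤ B) [Module.Finite k (M ⧸ B)]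
    [Module.Finite k (B ⧸ A.submoduleOf B)] :
    Module.Finite k (M ⧸ A) ∧ Module.finrank k (M ⧸ A) =
      Module.finrank k (M ⧸ B) + Module.finrank k (B ⧸ A.submoduleOf B) := by
  let e₁ : ((M ⧸ A) ⧸ B.map A.mkQ) ≃ₗ[k] M ⧸ B := Submodule.quotientQuotientEquivQuotient A B h
  let f : B →ₗ[k] M ⧸ A := A.mkQ ∘ₗ B.subtype
  have hker : LinearMap.ker f = A.submoduleOf B := by
    rw [LinearMap.ker_comp, Submodule.ker_mkQ]; rfl
  have hran : LinearMap.range f = B.map A.mkQ := by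
    rw [LinearMap.range_comp, Submodule.range_subtype]
  let e₂ : (B ⧸ A.submoduleOf B) ≃ₗ[k] B.map A.mkQ :=
    (Submodule.quotEquivOfEq _ _ hker.symm).trans
      (f.quotKerEquivRange.trans (LinearEquiv.ofEq _ _ hran))
  have : Module.Finite k ((M ⧸ A) ⧸ B.map A.mkQ) := Module.Finite.equiv e₁.symm
  have : Module.Finite k (B.map A.mkQ) := Module.Finite.equiv e₂
  have : Module.Finite k (M ⧸ A) := Module.Finite.of_submodule_quotient (B.map A.mkQ)
  refine ⟨this, ?_⟩
  rw [← e₁.finrank_eq, e₂.finrank_eq, Submodule.finrank_quotient_add_finrank]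

section

variable {k : Type} [Field k] {m : ℕ}

/-- The vector of constant coefficients. -/
noncomputable def constCoeffs (k : Type) [Field k] (m : ℕ) :
    (Fin m → PowerSeries k) →ₗ[k] (Fin m → k) :=
  LinearMap.pi fun i => (PowerSeries.coeff 0) ∘ₗ LinearMap.proj i

/-- The `2`-jets on every branch. -/
noncomputable def twoJets (k : Type) [Field k] (m : ℕ) :
    (Fin m → PowerSeries k) →ₗ[k] (Fin m × Fin 2 → k) :=
  LinearMap.pi fun p => (PowerSeries.coeff (p.2 : ℕ)) ∘ₗ LinearMap.proj p.1

/-- The uniformizer `(t₁, …, t_m)`. -/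
noncomputable def uniformizer (k : Type) [Field k] (m : ℕ) : Fin m → PowerSeries k :=
  fun _ => PowerSeries.X

theorem constCoeffs_surjective : Function.Surjective (constCoeffs k m) := fun v =>
  ⟨fun i => PowerSeries.C (v i), by ext i; simp [constCoeffs]⟩

theorem twoJets_surjective : Function.Surjective (twoJets k m) := fun v =>
  ⟨fun i => PowerSeries.mk fun n => if h : n < 2 then v (i, ⟨n, h⟩) else 0, by
    ext ⟨i, j⟩
    simp only [twoJets, LinearMap.pi_apply, LinearMap.comp_apply, LinearMap.proj_apply,
      PowerSeries.coeff_mk, j.2, dite_true]⟩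

theorem uniformizer_pow_dvd_iff {n : ℕ} {g : Fin m → PowerSeries k} :
    uniformizer k m ^ n ∣ g ↔ ∀ i, (PowerSeries.X : PowerSeries k) ^ n ∣ g i := by
  rw [pi_dvd_iff]; rfl

theorem uniformizer_dvd_iff {g : Fin m → PowerSeries k} :
    uniformizer k m ∣ g ↔ constCoeffs k m g = 0 := by
  rw [← pow_one (uniformizer k m), uniformizer_pow_dvd_iff, funext_iff]
  refine forall_congr' fun i => ?_
  rw [pow_one, PowerSeries.X_dvd_iff]
  simp [constCoeffs]

theorem uniformizer_sq_dvd_iff {g : Fin m → PowerSeries k} :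
    uniformizer k m ^ 2 ∣ g ↔ twoJets k m g = 0 := by
  rw [uniformizer_pow_dvd_iff, funext_iff, Prod.forall]
  refine forall_congr' fun i => ?_
  rw [PowerSeries.X_pow_dvd_iff]
  exact ⟨fun h j => h j j.2, fun h j hj => h ⟨j, hj⟩⟩

/-- Elements of a local subalgebra have the same value on all branches. -/
theorem constCoeffs_mem_span_one (R : Subalgebra k (Fin m → PowerSeries k)) [IsLocalRing R]
    {r : Fin m → PowerSeries k} (hr : r ∈ R) :
    constCoeffs k m r ∈ k ∙ (1 : Fin m → k) := by
  rcases m.eq_zero_or_pos with rfl | hm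
  · rw [Subsingleton.elim (constCoeffs k 0 r) 0]
    exact zero_mem _
  let a : k := constCoeffs k m r ⟨0, hm⟩
  refine Submodule.mem_span_singleton.2 ⟨a, funext fun i => ?_⟩
  have hnu : ∀ s : R, ∀ j, constCoeffs k m s.1 j = 0 → ¬ IsUnit s := by
    intro s j hj hs
    have h := hs.map (((PowerSeries.constantCoeff (R := k)).comp
      (Pi.evalRingHom (fun _ => PowerSeries k) j)).comp R.val.toRingHom)
    refine h.ne_zero ?_
    simpa [constCoeffs] using hj
  let s : R := ⟨r, hr⟩ - algebraMap k R a
  have hval : ∀ j, constCoeffs k m s.1 j = constCoeffs k m r j - a := by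
    intro j
    have : s.1 = r - a • 1 := by
      simp [s, Algebra.algebraMap_eq_smul_one]
    rw [this, map_sub, map_smul]
    simp [constCoeffs]
  have hs : ¬ IsUnit s := hnu s ⟨0, hm⟩ (by rw [hval, sub_self])
  by_contra hne
  have hb : constCoeffs k m r i - a ≠ 0 := fun h => hne (by simpa using (sub_eq_zero.1 h).symm)
  set b := constCoeffs k m r i - a with hb'
  have ht : ¬ IsUnit (s - algebraMap k R b) := by
    refine hnu _ i ?_
    have : (s - algebraMap k R b).1 = s.1 - b • 1 := by
      simp [Algebra.algebraMap_eq_smul_one]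
    rw [this, map_sub, map_smul, Pi.sub_apply, hval]
    simp [constCoeffs, hb']
  have hbu : IsUnit (algebraMap k R b) := (IsUnit.mk0 b hb).map _
  have := (IsLocalRing.nonunits_add (a := s) (b := -(s - algebraMap k R b)) hs
    (fun h => ht ((IsUnit.neg_iff _).1 h)))
  exact this (by simpa using hbu)

/-- The conductor, viewed as an ideal of the normalization. -/
def conductorUpstairs (R : Subalgebra k (Fin m → PowerSeries k)) :
    Ideal (Fin m → PowerSeries k) where
  carrier := {g | ∀ h, g * h ∈ R}
  add_mem' ha hb h := by rw [add_mul]; exact add_mem (ha h) (hb h)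
  zero_mem' h := by rw [zero_mul]; exact zero_mem R
  smul_mem' c x hx h := by
    rw [smul_eq_mul, mul_comm c x, mul_assoc]; exact hx _

theorem conductorUpstairs_le {R : Subalgebra k (Fin m → PowerSeries k)}
    {g : Fin m → PowerSeries k} (hg : g ∈ conductorUpstairs R) : g ∈ R := by
  simpa using hg 1

theorem mem_conductorIdeal {R : Subalgebra k (Fin m → PowerSeries k)} {r : R} :
    r ∈ conductorIdeal k m R ↔ (r : Fin m → PowerSeries k) ∈ conductorUpstairs R := by
  rw [conductorIdeal, Module.mem_annihilator]
  constructor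
  · intro h g
    have := h (Submodule.Quotient.mk g)
    rw [← Submodule.Quotient.mk_smul, Submodule.Quotient.mk_eq_zero] at this
    obtain ⟨s, hs⟩ := this
    have : (s : Fin m → PowerSeries k) = r * g := hs
    exact this ▸ s.2
  · intro h q
    obtain ⟨g, rfl⟩ := Submodule.Quotient.mk_surjective _ q
    rw [← Submodule.Quotient.mk_smul, Submodule.Quotient.mk_eq_zero]
    exact ⟨⟨_, h g⟩, rfl⟩

/-- An ideal of finite codimension contains a power of the uniformizer. -/
theorem exists_uniformizer_pow_mem (J : Ideal (Fin m → PowerSeries k))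
    [Module.Finite k ((Fin m → PowerSeries k) ⧸ J)] : ∃ n, uniformizer k m ^ n ∈ J := by
  have : IsArtinianRing ((Fin m → PowerSeries k) ⧸ J) := IsArtinianRing.of_finite k _
  have hx : Ideal.Quotient.mk J (uniformizer k m) ∈
      Ideal.jacobson (⊥ : Ideal ((Fin m → PowerSeries k) ⧸ J)) := by
    rw [Ideal.mem_jacobson_bot]
    intro y
    obtain ⟨y, rfl⟩ := Ideal.Quotient.mk_surjective y
    rw [← map_mul, ← map_one (Ideal.Quotient.mk J), ← map_add]
    refine IsUnit.map _ (Pi.isUnit_iff.2 fun i => ?_)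
    rw [PowerSeries.isUnit_iff_constantCoeff]
    simp [uniformizer]
  obtain ⟨n, hn⟩ := IsArtinianRing.isNilpotent_jacobson_bot
    (R := (Fin m → PowerSeries k) ⧸ J)
  refine ⟨n, ?_⟩
  rw [← Ideal.Quotient.eq_zero_iff_mem, map_pow]
  have := Ideal.pow_mem_pow hx n
  rwa [hn] at this

/-- If `R` generates the maximal ideal of the normalization modulo its square, it does so modulo
every power. -/
theorem exists_mem_sub_dvd (R : Subalgebra k (Fin m → PowerSeries k))
    (h : ∀ g, uniformizer k m ∣ g → ∃ r ∈ R, uniformizer k m ^ 2 ∣ g - r) (n : ℕ)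
    (g : Fin m → PowerSeries k) (hg : uniformizer k m ∣ g) :
    ∃ r ∈ R, uniformizer k m ^ (n + 1) ∣ g - r := by
  have key : ∀ n : ℕ, ∀ g, uniformizer k m ^ (n + 1) ∣ g →
      ∃ r ∈ R, uniformizer k m ^ (n + 1) ∣ r ∧ uniformizer k m ^ (n + 2) ∣ g - r := by
    intro n
    induction n with
    | zero =>
      intro g hg
      rw [zero_add, pow_one] at hg
      obtain ⟨r, hr, hd⟩ := h g hg
      refine ⟨r, hr, ?_, hd⟩
      rw [zero_add, pow_one]
      have := (dvd_pow_self (uniformizer k m) two_ne_zero).trans hd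
      simpa using dvd_sub hg this
    | succ n ih =>
      rintro g ⟨c, rfl⟩
      obtain ⟨r, hr, ⟨r', rfl⟩, s, hs⟩ :=
        ih (uniformizer k m ^ (n + 1) * c) (dvd_mul_right _ _)
      obtain ⟨u, hu, hud⟩ := h (uniformizer k m) dvd_rfl
      have hu1 : uniformizer k m ∣ u := by
        have := (dvd_pow_self (uniformizer k m) two_ne_zero).trans hud
        simpa using dvd_sub dvd_rfl this
      obtain ⟨v, hv⟩ := hud
      refine ⟨_, mul_mem hu hr, ?_, ?_⟩
      · rw [pow_succ' _ (n + 1)]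
        exact mul_dvd_mul hu1 (dvd_mul_right _ _)
      · refine ⟨s + v * r', ?_⟩
        linear_combination uniformizer k m * hs + uniformizer k m ^ (n + 1) * r' * hv
  induction n with
  | zero => exact ⟨0, zero_mem R, by simpa using hg⟩
  | succ n ih =>
    obtain ⟨r, hr, hd⟩ := ih
    obtain ⟨s, hs, -, hd'⟩ := key n _ hd
    exact ⟨r + s, add_mem hr hs, by rwa [← sub_sub]⟩

end

/-- Let `R ⊂ R̃ = k[[t₁]] × ⋯ × k[[t_m]]` be a reduced complete local
one-dimensional Gorenstein `k`-algebra with `m` branches and genus one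
(`δ = dim_k(R̃/R) = m`).  Then the conductor ideal `I = Ann_R(R̃/R)` equals
`m_{R̃}²`, i.e. its image in `R̃` is exactly the set of tuples vanishing to
order `≥ 2` on every branch. -/
theorem stmt7 (k : Type) [Field k] [IsAlgClosed k] (m : ℕ) (hm : 1 ≤ m)
    (R : Subalgebra k (Fin m → PowerSeries k))
    (hred : IsReduced R)
    (hloc : IsLocalRing R)
    (hdim : ringKrullDim R = 1)
    (hnorm : integralClosure R (Fin m → PowerSeries k) = ⊤)
    (hbr : Function.Injective fun i : Fin m =>
      RingHom.ker ((Pi.evalRingHom (fun _ => PowerSeries k) i).comp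
        (Subalgebra.val R).toRingHom))
    (hδ : Module.finrank k
        ((Fin m → PowerSeries k) ⧸ Subalgebra.toSubmodule R) = m)
    (hGor : Module.finrank k (R ⧸ conductorIdeal k m R) =
        Module.finrank k
          ((Fin m → PowerSeries k) ⧸ Subalgebra.toSubmodule R)) :
    (fun r : R => (r : Fin m → PowerSeries k)) '' (conductorIdeal k m R : Set R)
      = {g : Fin m → PowerSeries k |
          ∀ i : Fin m, g i ∈ (Ideal.span {PowerSeries.X}) ^ 2} := by
  let P := Fin m → PowerSeries k
  let Rk : Submodule k P := Subalgebra.toSubmodule R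
  have hRk : Module.finrank k (P ⧸ Rk) = m := hδ
  have hfinR : Module.Finite k (P ⧸ Rk) := Module.finite_of_finrank_pos (by omega)
  let J : Ideal P := conductorUpstairs R
  let Jk : Submodule k P := J.restrictScalars k
  have hJR : Jk ≤ Rk := fun g hg => conductorUpstairs_le hg
  -- Codimension of the conductor in the normalization
  let e : (Rk ⧸ Jk.submoduleOf Rk) ≃ₗ[k] R ⧸ conductorIdeal k m R :=
    (Submodule.quotEquivOfEq _ _ (by
      ext r
      exact (mem_conductorIdeal (r := r)).symm.trans
        (Ideal.Quotient.eq_zero_iff_mem (I := conductorIdeal k m R) (a := r)).symm)).trans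
      ((Ideal.Quotient.mkₐ k (conductorIdeal k m R)).toLinearMap.quotKerEquivOfSurjective
        (Ideal.Quotient.mkₐ_surjective k _))
  have hfinI : Module.Finite k (R ⧸ conductorIdeal k m R) :=
    Module.finite_of_finrank_pos (by rw [hGor, hδ]; omega)
  have : Module.Finite k (Rk ⧸ Jk.submoduleOf Rk) := Module.Finite.equiv e.symm
  obtain ⟨hfinJ, hJ⟩ := Submodule.finite_and_finrank_quotient_of_le hJR
  rw [e.finrank_eq, hGor, hδ] at hJ
  -- The seminormal ring `k + m_{R̃}`
  let q := (k ∙ (1 : Fin m → k)).mkQ ∘ₗ constCoeffs k m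
  have hq : Function.Surjective q :=
    (Submodule.mkQ_surjective _).comp constCoeffs_surjective
  have hqr : Module.finrank k (P ⧸ LinearMap.ker q) + 1 = m := by
    rw [(q.quotKerEquivOfSurjective hq).finrank_eq]
    have h1 := Submodule.finrank_quotient_add_finrank (k ∙ (1 : Fin m → k))
    have : Nonempty (Fin m) := ⟨⟨0, hm⟩⟩
    rwa [finrank_span_singleton one_ne_zero, Module.finrank_fin_fun] at h1
  have hmemq : ∀ g, g ∈ LinearMap.ker q ↔ constCoeffs k m g ∈ k ∙ (1 : Fin m → k) := by
    intro g
    rw [LinearMap.mem_ker]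
    exact Submodule.Quotient.mk_eq_zero _
  have hRq : Rk ≤ LinearMap.ker q := fun r hr => (hmemq r).2 (constCoeffs_mem_span_one R hr)
  -- The square of the maximal ideal
  let T : Submodule k P := LinearMap.ker (twoJets k m)
  have hT : Module.finrank k (P ⧸ T) = m + m := by
    rw [((twoJets k m).quotKerEquivOfSurjective twoJets_surjective).finrank_eq]
    simp [mul_two]
  have hfinT : Module.Finite k (P ⧸ T) := Module.finite_of_finrank_pos (by omega)
  have hmemT : ∀ g, g ∈ T ↔ uniformizer k m ^ 2 ∣ g := fun g =>
    LinearMap.mem_ker.trans uniformizer_sq_dvd_iff.symm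
  have hTq : T ≤ LinearMap.ker q := by
    intro g hg
    rw [hmemq, uniformizer_dvd_iff.1 ((dvd_pow_self _ two_ne_zero).trans ((hmemT g).1 hg))]
    exact zero_mem _
  have hTR : T ≤ Rk := by
    by_contra hcon
    have hne : Rk ≠ Rk ⊔ T := fun h => hcon (h ▸ le_sup_right)
    have hlt : Module.finrank k (P ⧸ (Rk ⊔ T)) < m := by
      by_contra hge
      exact hne (Submodule.eq_of_le_of_finrank_quotient_le le_sup_left (by omega))
    have : Module.Finite k (P ⧸ (Rk ⊔ T)) :=
      Module.Finite.of_surjective _ (Submodule.factor_surjective (le_sup_left : Rk ≤ Rk ⊔ T))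
    have hsup : Rk ⊔ T = LinearMap.ker q :=
      Submodule.eq_of_le_of_finrank_quotient_le (sup_le hRq hTq) (by omega)
    have hgen : ∀ g, uniformizer k m ∣ g → ∃ r ∈ R, uniformizer k m ^ 2 ∣ g - r := by
      intro g hg
      have : g ∈ Rk ⊔ T := by
        rw [hsup, hmemq, uniformizer_dvd_iff.1 hg]
        exact zero_mem _
      obtain ⟨r, hr, t, ht, rfl⟩ := Submodule.mem_sup.1 this
      exact ⟨r, hr, by simpa using (hmemT t).1 ht⟩
    have : Module.Finite k (P ⧸ J) := hfinJ
    obtain ⟨n, hn⟩ := exists_uniformizer_pow_mem J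
    refine hcon fun g hg => ?_
    obtain ⟨r, hr, hd⟩ := exists_mem_sub_dvd R hgen n g
      ((dvd_pow_self _ two_ne_zero).trans ((hmemT g).1 hg))
    have : g - r ∈ J := J.mem_of_dvd ((pow_dvd_pow _ n.le_succ).trans hd) hn
    have := add_mem (conductorUpstairs_le this) hr
    rwa [sub_add_cancel] at this
  have hTJ : T ≤ Jk := fun g hg h => hTR ((hmemT _).2 (((hmemT g).1 hg).mul_right h))
  have hEq : T = Jk := Submodule.eq_of_le_of_finrank_quotient_le hTJ (by omega)
  ext g
  have hset : g ∈ {g : P | ∀ i : Fin m, g i ∈ (Ideal.span {PowerSeries.X}) ^ 2} ↔ g ∈ T := by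
    rw [hmemT, uniformizer_pow_dvd_iff, Set.mem_ofPred_eq]
    refine forall_congr' fun i => ?_
    rw [Ideal.span_singleton_pow, Ideal.mem_span_singleton]
  rw [hset, hEq]
  constructor
  · rintro ⟨r, hr, rfl⟩
    exact mem_conductorIdeal.1 hr
  · intro hg
    exact ⟨⟨g, conductorUpstairs_le hg⟩, mem_conductorIdeal.2 hg, rfl⟩
end

section
/- Let R be a reduced complete local one-dimensional Gorenstein k-algebra with m branches and genus one. Then R is isomorphic to the complete local ring of the elliptic m-fold point: k[[x,y]]/(y²−x³) if m=1; k[[x,y]]/(y²−yx²) if m=2; k[[x,y]]/(x²y−xy²) if m=3; and k[[x₁,…,x_{m−1}]]/I_m with I_m = (x_h(x_i−x_j) : h,i,j distinct) if m ≥ 4. -/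
set_option synthInstance.maxHeartbeats 1000000
set_option maxHeartbeats 1000000

open MvPowerSeries in
/-- A `k`-algebra `R` is (the complete local ring of) an elliptic `m`-fold
point if it is isomorphic to `k[[x,y]]/(y²−x³)` (`m=1`),
`k[[x,y]]/(y²−yx²)` (`m=2`), `k[[x,y]]/(x²y−xy²)` (`m=3`), or
`k[[x₁,…,x_{m−1}]]/I_m` with `I_m = (x_h(x_i−x_j) : h,i,j distinct)`
(`m ≥ 4`). -/
def IsEllipticMFold (k : Type) [Field k] (m : ℕ)
    (R : Type) [CommRing R] [Algebra k R] : Prop :=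
  (m = 1 → Nonempty (R ≃ₐ[k] (MvPowerSeries (Fin 2) k ⧸
    Ideal.span {(X 1 : MvPowerSeries (Fin 2) k) ^ 2 - X 0 ^ 3}))) ∧
  (m = 2 → Nonempty (R ≃ₐ[k] (MvPowerSeries (Fin 2) k ⧸
    Ideal.span {(X 1 : MvPowerSeries (Fin 2) k) ^ 2 - X 1 * X 0 ^ 2}))) ∧
  (m = 3 → Nonempty (R ≃ₐ[k] (MvPowerSeries (Fin 2) k ⧸
    Ideal.span {(X 0 : MvPowerSeries (Fin 2) k) ^ 2 * X 1 - X 0 * X 1 ^ 2}))) ∧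
  (4 ≤ m → Nonempty (R ≃ₐ[k] (MvPowerSeries (Fin (m - 1)) k ⧸
    Ideal.span {f : MvPowerSeries (Fin (m - 1)) k |
      ∃ h i j : Fin (m - 1), h ≠ i ∧ h ≠ j ∧ i ≠ j ∧
        f = X h * (X i - X j)})))

namespace EllipticMFold

section Branches

variable {k : Type*} [Field k] {m : ℕ}

/-- The uniformizer `(t, …, t)` of the product of the branches. -/
noncomputable def unif : Fin m → PowerSeries k := fun _ => PowerSeries.X

@[simp]
theorem unif_apply (i : Fin m) : (unif i : PowerSeries k) = PowerSeries.X := rfl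

theorem constantCoeff_eq_of_isLocalRing (R : Subalgebra k (Fin m → PowerSeries k))
    (hloc : IsLocalRing R) {f : Fin m → PowerSeries k} (hf : f ∈ R) (i j : Fin m) :
    PowerSeries.constantCoeff (f i) = PowerSeries.constantCoeff (f j) := by
  by_contra h
  have hnon (l : Fin m) : ¬ IsUnit ((⟨f, hf⟩ : R) - algebraMap k R
      (PowerSeries.constantCoeff (f l))) := by
    intro hu
    have h1 := (hu.map R.val).map (Pi.evalRingHom (fun _ => PowerSeries k) l)
    have h2 := h1.map PowerSeries.constantCoeff
    simp at h2
  have hsum : IsUnit ((⟨f, hf⟩ - algebraMap k R (PowerSeries.constantCoeff (f i))) +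
      -((⟨f, hf⟩ : R) - algebraMap k R (PowerSeries.constantCoeff (f j)))) := by
    have : ((⟨f, hf⟩ - algebraMap k R (PowerSeries.constantCoeff (f i))) +
      -((⟨f, hf⟩ : R) - algebraMap k R (PowerSeries.constantCoeff (f j)))) =
      algebraMap k R (PowerSeries.constantCoeff (f j) - PowerSeries.constantCoeff (f i)) := by
      rw [map_sub]; ring
    rw [this]
    exact (IsUnit.mk0 _ (sub_ne_zero.2 fun e => h e.symm)).map _
  rcases IsLocalRing.isUnit_or_isUnit_of_isUnit_add hsum with h1 | h1
  · exact hnon i h1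
  · exact hnon j (by simpa using h1.neg)

theorem constantCoeff_aeval_apply (y : Fin m → PowerSeries k) (q : Polynomial k) (i : Fin m) :
    PowerSeries.constantCoeff (Polynomial.aeval y q i) =
      q.eval (PowerSeries.constantCoeff (y i)) := by
  induction q using Polynomial.induction_on' with
  | add p q hp hq => simp [hp, hq]
  | monomial n c => simp

/-- A nonzero polynomial in an element of the radical is a power of it times a unit. -/
theorem exists_aeval_eq_pow_mul {y : Fin m → PowerSeries k}
    (hy : ∀ i, PowerSeries.constantCoeff (y i) = 0) {p : Polynomial k} (hp : p ≠ 0) :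
    ∃ (r : ℕ) (u : (Fin m → PowerSeries k)ˣ), Polynomial.aeval y p = y ^ r * u := by
  obtain ⟨q, hq, hdvd⟩ := Polynomial.exists_eq_pow_rootMultiplicity_mul_and_not_dvd p hp 0
  rw [Polynomial.dvd_iff_isRoot] at hdvd
  have hu : IsUnit (Polynomial.aeval y q) := by
    rw [Pi.isUnit_iff]
    intro i
    rw [PowerSeries.isUnit_iff_constantCoeff, constantCoeff_aeval_apply, hy]
    exact IsUnit.mk0 _ hdvd
  refine ⟨p.rootMultiplicity 0, hu.unit, ?_⟩
  conv_lhs => rw [hq]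
  simp

theorem exists_pow_unif_mul_mem (R : Subalgebra k (Fin m → PowerSeries k))
    (hfin : Module.Finite k ((Fin m → PowerSeries k) ⧸ Subalgebra.toSubmodule R)) :
    ∃ N, ∀ a, unif ^ N * a ∈ R := by
  let S := Subalgebra.toSubmodule R
  obtain ⟨p, hp, hpR⟩ : ∃ p : Polynomial k, p ≠ 0 ∧ unif * Polynomial.aeval unif p ∈ R := by
    by_contra! h
    let φ : Polynomial k →ₗ[k] (Fin m → PowerSeries k) ⧸ S :=
      S.mkQ ∘ₗ LinearMap.mulLeft k unif ∘ₗ (Polynomial.aeval unif).toLinearMap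
    have hφ : Function.Injective φ := by
      rw [injective_iff_map_eq_zero]
      intro p hp
      by_contra h0
      exact h p h0 ((Submodule.Quotient.mk_eq_zero S).1 hp)
    exact Polynomial.not_finite (Module.Finite.of_injective φ hφ)
  obtain ⟨r, u, hu⟩ := exists_aeval_eq_pow_mul (y := (unif : Fin m → PowerSeries k))
    (fun i => by simp) hp
  set y : Fin m → PowerSeries k := unif * Polynomial.aeval unif p with hy
  have hy' : y = (unif : Fin m → PowerSeries k) ^ (r + 1) * u := by rw [hy, hu]; ring
  have hy0 (i : Fin m) : PowerSeries.constantCoeff (y i) = 0 := by simp [hy]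
  have hle : S ≤ S.comap (LinearMap.mulLeft k y) := fun f hf => R.mul_mem hpR hf
  let T : Module.End k ((Fin m → PowerSeries k) ⧸ S) := S.mapQ S (LinearMap.mulLeft k y) hle
  have hT (q : Polynomial k) (f : Fin m → PowerSeries k) :
      Polynomial.aeval T q (S.mkQ f) = S.mkQ (Polynomial.aeval y q * f) := by
    induction q using Polynomial.induction_on generalizing f with
    | C c =>
      rw [Polynomial.aeval_C, Polynomial.aeval_C, Module.algebraMap_end_apply, ← map_smul,
        Algebra.smul_def]
    | add p q hp hq => rw [map_add, map_add, LinearMap.add_apply, hp, hq, add_mul, map_add]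
    | monomial n c h =>
      have h1 : T (S.mkQ f) = S.mkQ (y * f) := rfl
      rw [pow_succ, ← mul_assoc, map_mul (Polynomial.aeval T), map_mul (Polynomial.aeval y),
        Polynomial.aeval_X, Polynomial.aeval_X, Module.End.mul_apply, h1, h, ← mul_assoc]
  obtain ⟨s, v, hv⟩ := exists_aeval_eq_pow_mul hy0 (LinearMap.charpoly_monic T).ne_zero
  refine ⟨(r + 1) * s, fun a => ?_⟩
  have h1 := hT T.charpoly (↑(u⁻¹ ^ s * v⁻¹) * a)
  rw [LinearMap.aeval_self_charpoly, LinearMap.zero_apply, hv, hy'] at h1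
  have h2 := (Submodule.Quotient.mk_eq_zero S).1 h1.symm
  refine Eq.subst (motive := (· ∈ R)) ?_ h2
  rw [mul_pow, ← pow_mul, Units.val_mul, Units.val_pow_eq_pow_val]
  have h3 : (u : Fin m → PowerSeries k) ^ s * ((u⁻¹ : (Fin m → PowerSeries k)ˣ) :
      Fin m → PowerSeries k) ^ s = 1 := by rw [← mul_pow, Units.mul_inv, one_pow]
  linear_combination (unif ^ ((r + 1) * s) * a) * h3 + unif ^ ((r + 1) * s) * a *
    (u : Fin m → PowerSeries k) ^ s * ((u⁻¹ : (Fin m → PowerSeries k)ˣ) :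
      Fin m → PowerSeries k) ^ s * v.mul_inv

/-- Modulo a local subalgebra of colength `m`, the series with equal constant terms are
one-dimensional. -/
theorem exists_forall_sub_smul_mem (hm : 1 ≤ m) (R : Subalgebra k (Fin m → PowerSeries k))
    (hloc : IsLocalRing R)
    (hδ : Module.finrank k ((Fin m → PowerSeries k) ⧸ Subalgebra.toSubmodule R) = m) :
    ∃ v : Fin m → PowerSeries k,
      (∀ i j, PowerSeries.constantCoeff (v i) = PowerSeries.constantCoeff (v j)) ∧ v ∉ R ∧
      ∀ f : Fin m → PowerSeries k,
        (∀ i j, PowerSeries.constantCoeff (f i) = PowerSeries.constantCoeff (f j)) →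
        ∃ c : k, f - c • v ∈ R := by
  let S := Subalgebra.toSubmodule R
  have hfin : Module.Finite k ((Fin m → PowerSeries k) ⧸ S) :=
    Module.finite_of_finrank_pos (by rw [hδ]; exact hm)
  let W : Submodule k (Fin m → k) := Submodule.span k {fun _ => 1}
  let ev : (Fin m → PowerSeries k) →ₗ[k] (Fin m → k) :=
    LinearMap.pi fun i => PowerSeries.coeff 0 ∘ₗ LinearMap.proj i
  have hev (f i) : ev f i = PowerSeries.constantCoeff (f i) := by simp [ev]
  have hker (f : Fin m → PowerSeries k) : (W.mkQ ∘ₗ ev) f = 0 ↔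
      ∀ i j, PowerSeries.constantCoeff (f i) = PowerSeries.constantCoeff (f j) := by
    rw [LinearMap.comp_apply, Submodule.mkQ_apply, Submodule.Quotient.mk_eq_zero,
      Submodule.mem_span_singleton]
    constructor
    · rintro ⟨c, hc⟩ i j
      rw [← hev, ← hev, ← hc]
      rfl
    · intro h
      refine ⟨ev f ⟨0, hm⟩, ?_⟩
      ext i
      simp [hev, h i ⟨0, hm⟩]
  let φ : ((Fin m → PowerSeries k) ⧸ S) →ₗ[k] (Fin m → k) ⧸ W :=
    S.liftQ (W.mkQ ∘ₗ ev) fun f hf =>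
      (hker f).2 (constantCoeff_eq_of_isLocalRing R hloc hf)
  have hsurj : Function.Surjective φ := by
    intro w
    obtain ⟨c, rfl⟩ := W.mkQ_surjective w
    refine ⟨S.mkQ fun i => PowerSeries.C (c i), ?_⟩
    change W.mkQ (ev _) = _
    congr 1
    ext i
    simp [hev]
  have h1 := φ.finrank_range_add_finrank_ker
  rw [LinearMap.range_eq_top.2 hsurj, finrank_top, hδ] at h1
  have h2 := W.finrank_quotient_add_finrank
  rw [finrank_span_singleton (fun e => one_ne_zero (congrFun e ⟨0, hm⟩)), Module.finrank_fin_fun]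
    at h2
  have h3 : Module.finrank k (LinearMap.ker φ) = 1 := by omega
  obtain ⟨⟨v, hv⟩, hv0, hspan⟩ := finrank_eq_one_iff'.1 h3
  obtain ⟨v, rfl⟩ := S.mkQ_surjective v
  refine ⟨v, (hker v).1 hv, fun h => hv0 ?_, fun f hf => ?_⟩
  · exact Subtype.ext ((Submodule.Quotient.mk_eq_zero S).2 h)
  · obtain ⟨c, hc⟩ := hspan ⟨S.mkQ f, (hker f).2 hf⟩
    refine ⟨c, ?_⟩
    have h4 : c • S.mkQ v = S.mkQ f := congrArg Subtype.val hc
    rw [← map_smul, eq_comm, ← sub_eq_zero, ← map_sub] at h4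
    exact (Submodule.Quotient.mk_eq_zero S).1 h4

theorem unif_sq_mul_mem (R : Subalgebra k (Fin m → PowerSeries k))
    (hN : ∃ N, ∀ a, unif ^ N * a ∈ R) {v : Fin m → PowerSeries k}
    (hv : ∀ f : Fin m → PowerSeries k,
        (∀ i j, PowerSeries.constantCoeff (f i) = PowerSeries.constantCoeff (f j)) →
        ∃ c : k, f - c • v ∈ R) (a : Fin m → PowerSeries k) : unif ^ 2 * a ∈ R := by
  obtain ⟨N, hN⟩ := hN
  have hN' : ∀ a, unif ^ (N + 2) * a ∈ R := fun a => by
    rw [pow_add, mul_assoc]; exact hN _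
  clear hN
  induction N generalizing a with
  | zero => simpa using hN' a
  | succ M ih =>
    refine ih a fun b => ?_
    by_contra hb
    set w := unif ^ (M + 2) * b with hw
    have hspan (f : Fin m → PowerSeries k)
        (hf : ∀ i, PowerSeries.constantCoeff (f i) = 0) : ∃ c : k, f - c • w ∈ R := by
      obtain ⟨c, hc⟩ := hv f (by simp [hf])
      obtain ⟨d, hd⟩ := hv w (by simp [hw])
      have hd0 : d ≠ 0 := by
        rintro rfl
        exact hb (by simpa using hd)
      refine ⟨c / d, ?_⟩
      have := R.sub_mem hc (R.smul_mem hd (c / d))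
      convert this using 1
      rw [smul_sub, smul_smul, div_mul_cancel₀ _ hd0]
      abel
    obtain ⟨c₁, h₁⟩ := hspan unif (by simp)
    obtain ⟨c₂, h₂⟩ := hspan (unif ^ (M + 1) * b) (by simp)
    apply hb
    have h3 := R.mul_mem h₁ h₂
    have h4 := hN' (c₁ • (unif ^ M * b * b) + c₂ • b - (c₁ * c₂) • (unif ^ (M + 1) * b * b))
    convert R.add_mem h3 h4 using 1
    simp only [hw, Algebra.smul_def, map_mul]
    ring

theorem exists_eq_add_unif_sq_mul (f : Fin m → PowerSeries k) {c : k}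
    (hc : ∀ i, PowerSeries.constantCoeff (f i) = c) :
    ∃ h, f = algebraMap k (Fin m → PowerSeries k) c +
      ∑ i, PowerSeries.coeff 1 (f i) • (Pi.single i PowerSeries.X : Fin m → PowerSeries k) +
        unif ^ 2 * h := by
  have hdvd (i : Fin m) : (PowerSeries.X : PowerSeries k) ^ 2 ∣
      f i - PowerSeries.C c - PowerSeries.coeff 1 (f i) • PowerSeries.X := by
    rw [PowerSeries.X_pow_dvd_iff]
    intro d hd
    interval_cases d
    · simp [hc]
    · simp
  choose h hh using hdvd
  refine ⟨h, ?_⟩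
  ext1 i
  have h1 : (∑ j, PowerSeries.coeff 1 (f j) •
      (Pi.single j PowerSeries.X : Fin m → PowerSeries k)) i =
      PowerSeries.coeff 1 (f i) • PowerSeries.X := by
    rw [Finset.sum_apply, Finset.sum_eq_single i]
    · simp
    · intro j _ hj
      simp [Pi.single_eq_of_ne hj.symm]
    · simp
  simp only [Pi.add_apply, Pi.mul_apply, Pi.pow_apply, unif_apply, h1, ← hh]
  simp only [Pi.algebraMap_apply, PowerSeries.algebraMap_apply, Algebra.algebraMap_self_apply]
  ring

theorem exists_mem_iff (hm : 1 ≤ m) (R : Subalgebra k (Fin m → PowerSeries k))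
    (hloc : IsLocalRing R)
    (hδ : Module.finrank k ((Fin m → PowerSeries k) ⧸ Subalgebra.toSubmodule R) = m) :
    ∃ a : Fin m → k, a ≠ 0 ∧ ∀ f, f ∈ R ↔
      (∀ i j, PowerSeries.constantCoeff (f i) = PowerSeries.constantCoeff (f j)) ∧
      ∑ i, a i * PowerSeries.coeff 1 (f i) = 0 := by
  obtain ⟨v, hv, hvR, hspan⟩ := exists_forall_sub_smul_mem hm R hloc hδ
  have hsq := unif_sq_mul_mem R (exists_pow_unif_mul_mem R
    (Module.finite_of_finrank_pos (by rw [hδ]; exact hm))) hspan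
  have hX (i : Fin m) : ∃ c : k,
      (Pi.single i PowerSeries.X : Fin m → PowerSeries k) - c • v ∈ R := by
    have h0 (j : Fin m) : PowerSeries.constantCoeff
        ((Pi.single i PowerSeries.X : Fin m → PowerSeries k) j) = 0 := by
      rcases eq_or_ne j i with rfl | h
      · simp
      · simp [Pi.single_eq_of_ne h]
    exact hspan _ fun j l => (h0 j).trans (h0 l).symm
  choose a ha using hX
  have hsmul (c : k) : c • v ∈ R ↔ c = 0 := by
    refine ⟨fun h => by_contra fun hc => hvR ?_, ?_⟩
    · simpa [smul_smul, inv_mul_cancel₀ hc] using R.smul_mem h c⁻¹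
    · rintro rfl
      simp
  have hmem (f : Fin m → PowerSeries k)
      (hf : ∀ i j, PowerSeries.constantCoeff (f i) = PowerSeries.constantCoeff (f j)) :
      f ∈ R ↔ ∑ i, a i * PowerSeries.coeff 1 (f i) = 0 := by
    obtain ⟨h, hh⟩ := exists_eq_add_unif_sq_mul f (hf · ⟨0, hm⟩)
    have hr : algebraMap k _ (PowerSeries.constantCoeff (f ⟨0, hm⟩)) +
        ∑ i, PowerSeries.coeff 1 (f i) •
          ((Pi.single i PowerSeries.X : Fin m → PowerSeries k) - a i • v) + unif ^ 2 * h ∈ R :=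
      R.add_mem (R.add_mem (R.algebraMap_mem _)
        (R.sum_mem fun i _ => R.smul_mem (ha i) _)) (hsq h)
    have he : f = algebraMap k _ (PowerSeries.constantCoeff (f ⟨0, hm⟩)) +
        ∑ i, PowerSeries.coeff 1 (f i) •
          ((Pi.single i PowerSeries.X : Fin m → PowerSeries k) - a i • v) + unif ^ 2 * h +
        (∑ i, a i * PowerSeries.coeff 1 (f i)) • v := by
      refine hh.trans ?_
      simp only [smul_sub, Finset.sum_sub_distrib, Finset.sum_smul, smul_smul, mul_comm (a _)]
      abel
    exact (iff_of_eq (congrArg (· ∈ R) he)).trans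
      ((Submodule.add_mem_iff_right (Subalgebra.toSubmodule R) hr).trans (hsmul _))
  refine ⟨a, ?_, fun f => ⟨fun hf => ?_, fun hf => (hmem f hf.1).2 hf.2⟩⟩
  · rintro rfl
    exact hvR ((hmem v hv).2 (by simp))
  · have h := constantCoeff_eq_of_isLocalRing R hloc hf
    exact ⟨h, (hmem f h).1 hf⟩

end Branches

section Gorenstein

variable {k : Type} [Field k] {m : ℕ}

theorem mem_conductorIdeal {R : Subalgebra k (Fin m → PowerSeries k)} {r : R} :
    r ∈ conductorIdeal k m R ↔ ∀ f, (r : Fin m → PowerSeries k) * f ∈ R := by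
  rw [conductorIdeal, Module.mem_annihilator]
  constructor
  · intro h f
    have h1 := h (Submodule.Quotient.mk f)
    rw [← Submodule.Quotient.mk_smul, Submodule.Quotient.mk_eq_zero] at h1
    obtain ⟨s, hs⟩ := h1
    have : (s : Fin m → PowerSeries k) = r * f := hs
    rw [← this]
    exact s.2
  · intro h f
    obtain ⟨f, rfl⟩ := Submodule.Quotient.mk_surjective _ f
    rw [← Submodule.Quotient.mk_smul, Submodule.Quotient.mk_eq_zero]
    exact ⟨⟨_, h f⟩, rfl⟩

theorem forall_ne_zero_of_finrank_conductorIdeal (R : Subalgebra k (Fin m → PowerSeries k))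
    (a : Fin m → k) (ha : a ≠ 0)
    (hR : ∀ f, f ∈ R ↔
      (∀ i j, PowerSeries.constantCoeff (f i) = PowerSeries.constantCoeff (f j)) ∧
      ∑ i, a i * PowerSeries.coeff 1 (f i) = 0)
    (hGor : Module.finrank k (R ⧸ conductorIdeal k m R) = m) (i : Fin m) : a i ≠ 0 := by
  intro hi
  obtain ⟨j, hj⟩ := Function.ne_iff.1 ha
  have hji : j ≠ i := by
    rintro rfl
    exact hj hi
  let L : R →ₗ[k] (Fin m → k) := LinearMap.pi fun l =>
    if l = i then PowerSeries.coeff 0 ∘ₗ LinearMap.proj i ∘ₗ R.val.toLinearMap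
    else a l • (PowerSeries.coeff 1 ∘ₗ LinearMap.proj l ∘ₗ R.val.toLinearMap)
  have hLi (r : R) : L r i = PowerSeries.constantCoeff ((r : Fin m → PowerSeries k) i) := by
    simp [L]
  have hLl (r : R) (l : Fin m) (hl : l ≠ i) :
      L r l = a l * PowerSeries.coeff 1 ((r : Fin m → PowerSeries k) l) := by
    simp [L, hl]
  let π : R →ₗ[k] R ⧸ conductorIdeal k m R :=
    (Ideal.Quotient.mkₐ k (conductorIdeal k m R)).toLinearMap
  have hker : LinearMap.ker L ≤ LinearMap.ker π := by
    intro r hr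
    rw [LinearMap.mem_ker] at hr
    have h0 (l : Fin m) : PowerSeries.constantCoeff ((r : Fin m → PowerSeries k) l) = 0 := by
      rw [((hR r).1 r.2).1 l i, ← hLi, hr, Pi.zero_apply]
    have h1 (l : Fin m) : a l * PowerSeries.coeff 1 ((r : Fin m → PowerSeries k) l) = 0 := by
      rcases eq_or_ne l i with rfl | hl
      · simp [hi]
      · rw [← hLl r l hl, hr, Pi.zero_apply]
    refine Ideal.Quotient.eq_zero_iff_mem.2 (mem_conductorIdeal.2 fun f => (hR _).2 ⟨?_, ?_⟩)
    · simp [h0]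
    · refine Finset.sum_eq_zero fun l _ => ?_
      rw [Pi.mul_apply, PowerSeries.coeff_mul, Finset.Nat.antidiagonal_succ]
      simp [h0, ← mul_assoc, h1]
  have hsurj : Function.Surjective ((LinearMap.ker L).liftQ π hker) := by
    rw [← LinearMap.range_eq_top, Submodule.range_liftQ, LinearMap.range_eq_top]
    exact Ideal.Quotient.mk_surjective
  have hfin : Module.Finite k (R ⧸ LinearMap.ker L) :=
    Module.Finite.equiv L.quotKerEquivRange.symm
  have h1 := LinearMap.finrank_le_finrank_of_surjective hsurj
  rw [hGor, L.quotKerEquivRange.finrank_eq] at h1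
  have h2 : LinearMap.range L ≠ ⊤ := by
    intro h
    obtain ⟨r, hr⟩ := LinearMap.range_eq_top.1 h (Pi.single j 1)
    have h3 := ((hR r).1 r.2).2
    rw [Finset.sum_eq_single j] at h3
    · rw [← hLl r j hji, hr] at h3
      simp at h3
    · intro l _ hl
      rcases eq_or_ne l i with rfl | hli
      · simp [hi]
      · rw [← hLl r l hli, hr, Pi.single_eq_of_ne hl]
    · simp
  have h4 := Submodule.finrank_lt h2
  rw [Module.finrank_fin_fun] at h4
  omega

end Gorenstein

section Parametrization

open MvPowerSeries Finsupp

variable {k : Type*} [Field k] {n : ℕ}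

/-- The finitely many exponents of weight `N`. -/
noncomputable def weightFiber (w : Fin n → ℕ) (hw : ∀ i, w i ≠ 0) (N : ℕ) :
    Finset (Fin n →₀ ℕ) :=
  (finite_of_nat_weight_eq w hw N).toFinset

@[simp]
theorem mem_weightFiber {w : Fin n → ℕ} {hw : ∀ i, w i ≠ 0} {N : ℕ} {d : Fin n →₀ ℕ} :
    d ∈ weightFiber w hw N ↔ weight w d = N := by
  simp [weightFiber]

theorem hasSubst_monomial (w : Fin n → ℕ) (hw : ∀ i, w i ≠ 0) (α : Fin n → k) :
    HasSubst fun i => (PowerSeries.monomial (w i) (α i) : PowerSeries k) :=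
  hasSubst_of_constantCoeff_zero fun i => by
    have := PowerSeries.coeff_monomial (R := k) 0 (w i) (α i)
    rw [if_neg (hw i).symm] at this
    rwa [PowerSeries.coeff_zero_eq_constantCoeff_apply] at this

/-- The substitution `xᵢ ↦ αᵢ t ^ wᵢ`. -/
noncomputable def monomialSubst (w : Fin n → ℕ) (hw : ∀ i, w i ≠ 0) (α : Fin n → k) :
    MvPowerSeries (Fin n) k →ₐ[k] PowerSeries k :=
  substAlgHom (hasSubst_monomial w hw α)

theorem monomialSubst_X (w : Fin n → ℕ) (hw : ∀ i, w i ≠ 0) (α : Fin n → k) (i : Fin n) :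
    monomialSubst w hw α (X i) = PowerSeries.monomial (w i) (α i) :=
  substAlgHom_X (hasSubst_monomial w hw α) i

theorem monomial_prod_pow (w : Fin n → ℕ) (α : Fin n → k) (d : Fin n →₀ ℕ) :
    (d.prod fun i e => (PowerSeries.monomial (w i) (α i) : PowerSeries k) ^ e) =
      PowerSeries.monomial (weight w d) (∏ i, α i ^ d i) := by
  rw [Finsupp.prod_fintype _ _ (by simp)]
  simp only [PowerSeries.monomial_pow, PowerSeries.prod_monomial, weight_eq_sum, smul_eq_mul]

theorem coeff_monomialSubst (w : Fin n → ℕ) (hw : ∀ i, w i ≠ 0) (α : Fin n → k)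
    (F : MvPowerSeries (Fin n) k) (N : ℕ) :
    PowerSeries.coeff N (monomialSubst w hw α F) =
      ∑ d ∈ weightFiber w hw N, coeff d F * ∏ i, α i ^ d i := by
  rw [monomialSubst, substAlgHom_apply, PowerSeries.coeff, coeff_subst (hasSubst_monomial w hw α)]
  rw [finsum_eq_sum_of_support_subset (s := weightFiber w hw N)]
  · refine Finset.sum_congr rfl fun d hd => ?_
    rw [monomial_prod_pow]
    have := PowerSeries.coeff_monomial (R := k) N (weight w d) (∏ i, α i ^ d i)
    rw [if_pos (mem_weightFiber.1 hd).symm] at this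
    rw [smul_eq_mul]
    exact congrArg _ this
  · intro d hd
    by_contra h
    apply hd
    dsimp only
    rw [monomial_prod_pow]
    have := PowerSeries.coeff_monomial (R := k) N (weight w d) (∏ i, α i ^ d i)
    rw [if_neg fun e => h (by simpa using e.symm)] at this
    rw [smul_eq_mul]
    exact (congrArg _ this).trans (mul_zero _)

theorem mem_span_range_of_weight_components {ι : Type*} [Fintype ι] (w : Fin n → ℕ)
    (g : ι → MvPowerSeries (Fin n) k) (e : ι → ℕ)
    (hg : ∀ s d, coeff d (g s) ≠ 0 → weight w d = e s) (F : MvPowerSeries (Fin n) k)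
    (hF : ∀ N, ∃ G ∈ Ideal.span (Set.range g), ∀ d, weight w d = N → coeff d G = coeff d F) :
    F ∈ Ideal.span (Set.range g) := by
  choose G hG hGF using hF
  have h := fun N => Ideal.mem_span_range_iff_exists_fun.1 (hG N)
  choose c hc using h
  refine Ideal.mem_span_range_iff_exists_fun.2
    ⟨fun s => (fun p => coeff p (c (weight w p + e s) s) : MvPowerSeries (Fin n) k), ?_⟩
  ext D
  rw [← hGF _ D rfl, ← hc, map_sum, map_sum]
  refine Finset.sum_congr rfl fun s _ => ?_
  classical
  refine (coeff_mul D _ _).trans ((Finset.sum_congr rfl fun p hp => ?_).trans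
    (coeff_mul D _ _).symm)
  by_cases h0 : coeff p.2 (g s) = 0
  · simp [h0]
  · congr 1
    change coeff p.1 (c (weight w p.1 + e s) s) = _
    rw [← hg s _ h0, ← map_add, Finset.HasAntidiagonal.mem_antidiagonal.1 hp]

theorem mem_span_range_of_sum_weightFiber_eq_zero {ι : Type*} [Fintype ι] (w : Fin n → ℕ)
    (hw : ∀ i, w i ≠ 0) (g : ι → MvPowerSeries (Fin n) k) (e : ι → ℕ)
    (hg : ∀ s d, coeff d (g s) ≠ 0 → weight w d = e s) (T : Set (Fin n →₀ ℕ))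
    (hT : ∀ d ∈ T, ∀ d' ∈ T, weight w d = weight w d' →
      (monomial d (1 : k) - monomial d' 1 : MvPowerSeries (Fin n) k) ∈ Ideal.span (Set.range g))
    (F : MvPowerSeries (Fin n) k) (hF : ∀ d, coeff d F ≠ 0 → d ∈ T)
    (hsum : ∀ N, ∑ d ∈ weightFiber w hw N, coeff d F = 0) :
    F ∈ Ideal.span (Set.range g) := by
  classical
  refine mem_span_range_of_weight_components w g e hg F fun N => ?_
  by_cases h : ∃ d' ∈ T, weight w d' = N
  · obtain ⟨d', hd', rfl⟩ := h
    refine ⟨∑ d ∈ weightFiber w hw (weight w d'), C (coeff d F) *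
      (monomial d (1 : k) - monomial d' 1), ?_, fun D hD => ?_⟩
    · refine Ideal.sum_mem _ fun d hd => ?_
      by_cases h0 : coeff d F = 0
      · simp [h0]
      · exact Ideal.mul_mem_left _ _ (hT d (hF d h0) d' hd' (mem_weightFiber.1 hd))
    · simp only [map_sum, coeff_C_mul, map_sub, mul_sub, Finset.sum_sub_distrib]
      rw [← Finset.sum_mul, hsum, zero_mul, sub_zero]
      simp only [coeff_monomial, mul_ite, mul_one, mul_zero, Finset.sum_ite_eq, mem_weightFiber,
        hD, if_true]
  · refine ⟨0, Ideal.zero_mem _, fun d hd => ?_⟩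
    by_contra h0
    exact h ⟨d, hF d (by simpa using Ne.symm h0), hd⟩

/-- The series supported on the exponents `γ N` of weight `N`, with coefficients `u N`. -/
noncomputable def curveSeries (w : Fin n → ℕ) (γ : ℕ → Fin n →₀ ℕ) (u : ℕ → k) :
    MvPowerSeries (Fin n) k :=
  fun d => open Classical in if d = γ (weight w d) then u (weight w d) else 0

theorem coeff_monomialSubst_curveSeries (w : Fin n → ℕ) (hw : ∀ i, w i ≠ 0) (α : Fin n → k)
    (γ : ℕ → Fin n →₀ ℕ) (u : ℕ → k) (N : ℕ) (h : u N ≠ 0 → weight w (γ N) = N) :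
    PowerSeries.coeff N (monomialSubst w hw α (curveSeries w γ u)) =
      u N * ∏ i, α i ^ γ N i := by
  classical
  rw [coeff_monomialSubst]
  have key : ∀ d ∈ weightFiber w hw N, coeff d (curveSeries w γ u) * ∏ i, α i ^ d i =
      if d = γ N then u N * ∏ i, α i ^ γ N i else 0 := by
    intro d hd
    have : coeff d (curveSeries w γ u) = if d = γ N then u N else 0 := by
      rw [← mem_weightFiber.1 hd]; exact if_congr Iff.rfl rfl rfl
    rw [this]
    split_ifs with h1
    · rw [h1]
    · rw [zero_mul]
  rw [Finset.sum_congr rfl key, Finset.sum_ite_eq']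
  split_ifs with h1
  · rfl
  · by_cases h0 : u N = 0
    · simp [h0]
    · exact (h1 (mem_weightFiber.2 (h h0))).elim

theorem weightFiber_zero (w : Fin n → ℕ) (hw : ∀ i, w i ≠ 0) : weightFiber w hw 0 = {0} := by
  ext d
  have : NonTorsionWeight ℕ w := nonTorsionWeight_of ℕ w hw
  simp [weight_eq_zero_iff_eq_zero]

theorem coeff_zero_monomialSubst (w : Fin n → ℕ) (hw : ∀ i, w i ≠ 0) (α : Fin n → k)
    (F : MvPowerSeries (Fin n) k) :
    PowerSeries.coeff 0 (monomialSubst w hw α F) = coeff 0 F := by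
  simp [coeff_monomialSubst, weightFiber_zero]

theorem exists_eq_single_of_weight_eq_one {w : Fin n → ℕ} (hw : ∀ i, w i ≠ 0)
    {d : Fin n →₀ ℕ} (hd : weight w d = 1) : ∃ j, d = single j 1 ∧ w j = 1 := by
  have hne : d ≠ 0 := by rintro rfl; simp at hd
  obtain ⟨j, hj⟩ := Finsupp.ne_iff.1 hne
  have h1 := weight_sub_single_add (w := w) hj
  have hj' := hw j
  have : NonTorsionWeight ℕ w := nonTorsionWeight_of ℕ w hw
  have h2 : d - single j 1 = 0 := (weight_eq_zero_iff_eq_zero w).1 (by omega)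
  refine ⟨j, ?_, by omega⟩
  ext i
  have h3 := DFunLike.congr_fun h2 i
  rcases eq_or_ne j i with rfl | hi
  · simp at h3 hj ⊢
    omega
  · simpa [Finsupp.single_apply, hi] using h3

theorem sum_mul_coeff_one_monomialSubst {ι : Type*} [Fintype ι] (w : Fin n → ℕ)
    (hw : ∀ i, w i ≠ 0) (α : ι → Fin n → k) (a : ι → k)
    (h : ∀ j, w j = 1 → ∑ i, a i * α i j = 0) (F : MvPowerSeries (Fin n) k) :
    ∑ i, a i * PowerSeries.coeff 1 (monomialSubst w hw (α i) F) = 0 := by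
  simp only [coeff_monomialSubst, Finset.mul_sum]
  rw [Finset.sum_comm]
  refine Finset.sum_eq_zero fun d hd => ?_
  obtain ⟨j, rfl, hj⟩ := exists_eq_single_of_weight_eq_one hw (mem_weightFiber.1 hd)
  have (i : ι) : ∏ x, α i x ^ (single j 1) x = α i j := by
    rw [Finset.prod_eq_single j] <;> simp +contextual
  simp only [this]
  simp_rw [mul_left_comm (a _), ← Finset.mul_sum, h j hj, mul_zero]

theorem monomial_eq_prod_X_pow (d : Fin n →₀ ℕ) :
    (monomial d (1 : k) : MvPowerSeries (Fin n) k) = ∏ i, X i ^ d i := by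
  rw [monomial_one_eq, Finsupp.prod_fintype _ _ (by simp)]

theorem monomialSubst_monomial (w : Fin n → ℕ) (hw : ∀ i, w i ≠ 0) (α : Fin n → k)
    (d : Fin n →₀ ℕ) :
    monomialSubst w hw α (monomial d 1) =
      PowerSeries.monomial (weight w d) (∏ i, α i ^ d i) := by
  rw [monomial_eq_prod_X_pow, map_prod]
  simp only [map_pow, monomialSubst_X, PowerSeries.monomial_pow, PowerSeries.prod_monomial,
    weight_eq_sum, smul_eq_mul]

theorem mul_prod_pow_eq {Q : Type*} [CommRing Q] (y : Fin n → Q) (w : Fin n → ℕ) (z p : Q)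
    (h : ∀ l, z * y l = z * p ^ w l) (d : Fin n →₀ ℕ) :
    z * ∏ i, y i ^ d i = z * p ^ weight w d := by
  induction d using Finsupp.induction_linear with
  | zero => simp
  | add d e hd he =>
    simp only [Finsupp.add_apply, pow_add, Finset.prod_mul_distrib, map_add]
    rw [← mul_assoc, hd, mul_right_comm, he]
    ring
  | single j e =>
    rw [Finset.prod_eq_single j]
    · rw [single_eq_same, weight_single, smul_eq_mul]
      induction e with
      | zero => simp
      | succ e ih =>
        rw [pow_succ, ← mul_assoc, ih, mul_right_comm, h]
        ring
    · intro b _ hb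
      simp [hb.symm]
    · simp

/-- A subalgebra cut out by the constant terms and one linear relation is the quotient of a power
series ring by a binomial ideal, as soon as monomial substitutions parametrize it. -/
theorem nonempty_algEquiv_quotient {m : ℕ} (R : Subalgebra k (Fin m → PowerSeries k))
    (a : Fin m → k)
    (hR : ∀ f, f ∈ R ↔
      (∀ i j, PowerSeries.constantCoeff (f i) = PowerSeries.constantCoeff (f j)) ∧
      ∑ i, a i * PowerSeries.coeff 1 (f i) = 0)
    (w : Fin n → ℕ) (hw : ∀ i, w i ≠ 0) (α : Fin m → Fin n → k)
    (hα : ∀ j, w j = 1 → ∑ i, a i * α i j = 0)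
    (hsurj : ∀ f ∈ R, ∃ F, ∀ i, monomialSubst w hw (α i) F = f i)
    (i₁ : Fin m) (hi₁ : ∀ j, α i₁ j = 1)
    {ι : Type*} [Fintype ι] (p q : ι → Fin n →₀ ℕ)
    (hpq : ∀ s, weight w (p s) = weight w (q s))
    (hαpq : ∀ i s, ∏ j, α i j ^ p s j = ∏ j, α i j ^ q s j)
    (I : Ideal (MvPowerSeries (Fin n) k))
    (hI : I = Ideal.span (Set.range fun s => monomial (p s) (1 : k) - monomial (q s) 1))
    (T : Set (Fin n →₀ ℕ))
    (hT : ∀ d ∈ T, ∀ d' ∈ T, weight w d = weight w d' →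
      ∏ i, Ideal.Quotient.mk I (X i) ^ d i = ∏ i, Ideal.Quotient.mk I (X i) ^ d' i)
    (hTF : ∀ F, (∀ i, monomialSubst w hw (α i) F = 0) → ∀ d, coeff d F ≠ 0 → d ∈ T) :
    Nonempty (R ≃ₐ[k] (MvPowerSeries (Fin n) k ⧸ I)) := by
  let Φ : MvPowerSeries (Fin n) k →ₐ[k] (Fin m → PowerSeries k) :=
    AlgHom.pi fun i => monomialSubst w hw (α i)
  have hΦ (F) : Φ F ∈ R := by
    refine (hR _).2 ⟨fun i j => ?_, sum_mul_coeff_one_monomialSubst w hw α a hα F⟩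
    rw [← PowerSeries.coeff_zero_eq_constantCoeff_apply,
      ← PowerSeries.coeff_zero_eq_constantCoeff_apply]
    exact (coeff_zero_monomialSubst w hw (α i) F).trans
      (coeff_zero_monomialSubst w hw (α j) F).symm
  let Ψ : MvPowerSeries (Fin n) k →ₐ[k] R := Φ.codRestrict R hΦ
  have hΨ0 (F) : Ψ F = 0 ↔ ∀ i, monomialSubst w hw (α i) F = 0 := by
    rw [← Subtype.coe_inj, funext_iff]
    rfl
  have hΨ : Function.Surjective Ψ := by
    rintro ⟨f, hf⟩
    obtain ⟨F, hF⟩ := hsurj f hf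
    exact ⟨F, Subtype.ext (funext hF)⟩
  have hker : RingHom.ker Ψ = I := by
    apply le_antisymm
    · intro F hF
      have hF0 := (hΨ0 F).1 hF
      rw [hI]
      refine mem_span_range_of_sum_weightFiber_eq_zero w hw _ (fun s => weight w (p s))
        (fun s d hd => ?_) T (fun d hd d' hd' h => ?_) F (hTF F hF0) (fun N => ?_)
      · classical
        rw [map_sub, coeff_monomial, coeff_monomial] at hd
        by_cases h1 : d = p s
        · rw [h1]
        · by_cases h2 : d = q s
          · rw [h2, hpq]
          · simp [h1, h2] at hd
      · rw [← hI, ← Ideal.Quotient.eq, monomial_eq_prod_X_pow, monomial_eq_prod_X_pow, map_prod,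
          map_prod]
        simpa only [map_pow] using hT d hd d' hd' h
      · have := coeff_monomialSubst w hw (α i₁) F N
        rw [hF0, map_zero] at this
        simpa [hi₁] using this.symm
    · rw [hI, Ideal.span_le]
      rintro _ ⟨s, rfl⟩
      refine (hΨ0 _).2 fun i => ?_
      rw [map_sub, monomialSubst_monomial, monomialSubst_monomial, hpq, hαpq, sub_self]
  exact ⟨((Ideal.quotientEquivAlgOfEq k hker.symm).trans
    (Ideal.quotientKerAlgEquivOfSurjective hΨ)).symm⟩

theorem nonempty_algEquiv_cusp (R : Subalgebra k (Fin 1 → PowerSeries k))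
    (a : Fin 1 → k) (ha : ∀ i, a i ≠ 0)
    (hR : ∀ f, f ∈ R ↔
      (∀ i j, PowerSeries.constantCoeff (f i) = PowerSeries.constantCoeff (f j)) ∧
      ∑ i, a i * PowerSeries.coeff 1 (f i) = 0) :
    Nonempty (R ≃ₐ[k] (MvPowerSeries (Fin 2) k ⧸
      Ideal.span {(X 1 : MvPowerSeries (Fin 2) k) ^ 2 - X 0 ^ 3})) := by
  have hw : ∀ i, (![2, 3] : Fin 2 → ℕ) i ≠ 0 := by intro i; fin_cases i <;> simp
  refine nonempty_algEquiv_quotient R a hR ![2, 3] hw (fun _ _ => 1) ?_ ?_ 0 (fun _ => rfl)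
    (fun _ : Unit => single 1 2) (fun _ => single 0 3) ?_ ?_ _ ?_ Set.univ ?_ ?_
  · intro j
    fin_cases j <;> simp
  · intro f hf
    have h1 : PowerSeries.coeff 1 (f 0) = 0 := by
      have := ((hR f).1 hf).2
      simpa [ha] using this
    refine ⟨curveSeries ![2, 3] (fun N => if N % 2 = 0 then single 0 (N / 2) else
      single 0 ((N - 3) / 2) + single 1 1) fun N => PowerSeries.coeff N (f 0), fun i => ?_⟩
    rw [Subsingleton.elim i 0]
    ext N
    rw [coeff_monomialSubst_curveSeries]
    · simp
    · intro hN
      split_ifs with hp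
      · simp [weight_single]
        omega
      · have : N ≠ 1 := by rintro rfl; exact hN h1
        simp [weight_single]
        omega
  · simp [weight_single]
  · simp
  · simp [X_pow_eq]
  · intro d _ d' _ h
    set I := Ideal.span {(X 1 : MvPowerSeries (Fin 2) k) ^ 2 - X 0 ^ 3}
    have hrel : Ideal.Quotient.mk I (X 1) ^ 2 = Ideal.Quotient.mk I (X 0) ^ 3 := by
      rw [← map_pow, ← map_pow, Ideal.Quotient.eq]
      exact Ideal.subset_span rfl
    have hnf (x y : ℕ) : Ideal.Quotient.mk I (X 0) ^ x * Ideal.Quotient.mk I (X 1) ^ y =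
        Ideal.Quotient.mk I (X 0) ^ (x + 3 * (y / 2)) * Ideal.Quotient.mk I (X 1) ^ (y % 2) := by
      conv_lhs => rw [← Nat.div_add_mod y 2]
      rw [pow_add, pow_mul, hrel]
      ring
    simp only [weight_eq_sum, Fin.sum_univ_two, smul_eq_mul, Matrix.cons_val_zero,
      Matrix.cons_val_one] at h
    rw [Fin.prod_univ_two, Fin.prod_univ_two, hnf, hnf (d' 0)]
    congr 2 <;> omega
  · intros
    trivial

theorem nonempty_algEquiv_tacnode (R : Subalgebra k (Fin 2 → PowerSeries k))
    (a : Fin 2 → k) (ha : ∀ i, a i ≠ 0)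
    (hR : ∀ f, f ∈ R ↔
      (∀ i j, PowerSeries.constantCoeff (f i) = PowerSeries.constantCoeff (f j)) ∧
      ∑ i, a i * PowerSeries.coeff 1 (f i) = 0) :
    Nonempty (R ≃ₐ[k] (MvPowerSeries (Fin 2) k ⧸
      Ideal.span {(X 1 : MvPowerSeries (Fin 2) k) ^ 2 - X 1 * X 0 ^ 2})) := by
  have hw : ∀ i, (![1, 2] : Fin 2 → ℕ) i ≠ 0 := by intro i; fin_cases i <;> simp
  obtain ⟨s, hs, hs0⟩ : ∃ s : k, a 0 * s + a 1 = 0 ∧ s ≠ 0 :=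
    ⟨-a 1 / a 0, by field_simp [ha 0]; ring, div_ne_zero (neg_ne_zero.2 (ha 1)) (ha 0)⟩
  refine nonempty_algEquiv_quotient R a hR ![1, 2] hw ![![s, 0], ![1, 1]] ?_ ?_ 1 ?_
    (fun _ : Unit => single 1 2) (fun _ => single 1 1 + single 0 2) ?_ ?_ _ ?_
    {d | d 1 ≠ 0} ?_ ?_
  · intro j
    fin_cases j <;> simp [Fin.sum_univ_two, hs]
  · intro f hf
    obtain ⟨h0, h1⟩ := (hR f).1 hf
    rw [Fin.sum_univ_two] at h1
    let u : ℕ → k := fun N => s⁻¹ ^ N * PowerSeries.coeff N (f 0)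
    have hu : ∀ N < 2, PowerSeries.coeff N (f 1) - u N = 0 := by
      intro N hN
      interval_cases N
      · simp [u, h0 0 1]
      · have : a 1 = - (a 0 * s) := by linear_combination hs
        rw [this] at h1
        have h2 : a 0 * (PowerSeries.coeff 1 (f 0) - s * PowerSeries.coeff 1 (f 1)) = 0 := by
          linear_combination h1
        have h3 := (mul_eq_zero.1 h2).resolve_left (ha 0)
        simp only [u, pow_one]
        field_simp
        linear_combination -h3
    refine ⟨curveSeries ![1, 2] (fun N => single 0 N) u +
      curveSeries ![1, 2] (fun N => single 0 (N - 2) + single 1 1)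
        (fun N => PowerSeries.coeff N (f 1) - u N), fun i => ?_⟩
    ext N
    rw [map_add, map_add, coeff_monomialSubst_curveSeries, coeff_monomialSubst_curveSeries]
    · fin_cases i
      · simp [Fin.prod_univ_two, u]
        field_simp
      · simp [Fin.prod_univ_two]
    · intro hN
      have : ¬ N < 2 := fun h => hN (hu N h)
      rw [map_add, weight_single, weight_single]
      simp
      omega
    · simp [weight_single]
  · intro j
    fin_cases j <;> simp
  · simp [weight_single]
  · intro i _
    fin_cases i <;> simp [Fin.prod_univ_two]
  · rw [Set.range_const, X_pow_eq, X_pow_eq, X_def, monomial_mul_monomial, mul_one]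
  · set I := Ideal.span {(X 1 : MvPowerSeries (Fin 2) k) ^ 2 - X 1 * X 0 ^ 2}
    have hrel : Ideal.Quotient.mk I (X 1) ^ 2 =
        Ideal.Quotient.mk I (X 1) * Ideal.Quotient.mk I (X 0) ^ 2 := by
      rw [← map_pow, ← map_pow, ← map_mul, Ideal.Quotient.eq]
      exact Ideal.subset_span rfl
    have hnf (d : Fin 2 →₀ ℕ) (hd : d 1 ≠ 0) : ∏ i, Ideal.Quotient.mk I (X i) ^ d i =
        Ideal.Quotient.mk I (X 1) * Ideal.Quotient.mk I (X 0) ^ (weight ![1, 2] d - 2) := by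
      have h1 := weight_sub_single_add (w := ![1, 2]) hd
      have h2 := mul_prod_pow_eq (fun i => Ideal.Quotient.mk I (X i)) ![1, 2]
        (Ideal.Quotient.mk I (X 1)) (Ideal.Quotient.mk I (X 0))
        (fun l => by
          fin_cases l
          · simp
          · simpa [sq] using hrel) (d - single 1 1)
      rw [← h1]
      simp only [Matrix.cons_val_one, Nat.add_sub_cancel, Matrix.cons_val_fin_one] at h2 ⊢
      rw [← h2, Fin.prod_univ_two, Fin.prod_univ_two]
      obtain ⟨e, he⟩ := Nat.exists_eq_succ_of_ne_zero hd
      simp [he]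
      ring
    intro d hd d' hd' h
    rw [hnf d hd, hnf d' hd', h]
  · intro F hF d hd hd1
    apply hd
    have h := coeff_monomialSubst ![1, 2] hw ![s, 0] F (d 0)
    have hF0 := hF 0
    rw [Matrix.cons_val_zero] at hF0
    rw [hF0, map_zero, Finset.sum_eq_single d] at h
    · simpa [Fin.prod_univ_two, hd1, hs0] using h.symm
    · intro d' hd' hne
      have h1 : d' 1 ≠ 0 := by
        intro h1
        apply hne
        have h2 := mem_weightFiber.1 hd'
        simp [weight_eq_sum, Fin.sum_univ_two, h1] at h2
        ext i
        fin_cases i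
        · exact h2
        · exact h1.trans hd1.symm
      simp [Fin.prod_univ_two, h1]
    · intro h1
      simp [weight_eq_sum, Fin.sum_univ_two, hd1] at h1

theorem prod_pow_single {M : Type*} [CommMonoid M] (β : Fin n → M) (j : Fin n) (e : ℕ) :
    ∏ l, β l ^ (single j e) l = β j ^ e := by
  rw [Finset.prod_eq_single j]
  · simp
  · intro b _ hb
    simp [hb.symm]
  · simp

/-- At least two variables occur in the exponent. -/
def IsMixed (d : Fin n →₀ ℕ) : Prop :=
  ∃ i j, i ≠ j ∧ d i ≠ 0 ∧ d j ≠ 0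

theorem eq_single_of_forall_ne {d : Fin n →₀ ℕ} {j : Fin n} (h : ∀ l, l ≠ j → d l = 0) :
    d = single j (d j) := by
  ext l
  rcases eq_or_ne l j with rfl | hl
  · simp
  · simp [h l hl, hl.symm]

theorem exists_eq_single_of_not_isMixed [NeZero n] {d : Fin n →₀ ℕ} (hd : ¬ IsMixed d) :
    ∃ j e, d = single j e := by
  by_cases h0 : d = 0
  · exact ⟨0, 0, by simp [h0]⟩
  · obtain ⟨j, hj⟩ := Finsupp.ne_iff.1 h0
    refine ⟨j, _, eq_single_of_forall_ne fun l hl => ?_⟩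
    by_contra h
    exact hd ⟨l, j, hl, h, hj⟩

theorem prod_piSingle_pow_of_isMixed {d : Fin n →₀ ℕ} (hd : IsMixed d) (i : Fin n) (c : k) :
    ∏ l, (Pi.single i c : Fin n → k) l ^ d l = 0 := by
  obtain ⟨x, y, hxy, hx, hy⟩ := hd
  by_cases h : x = i
  · refine Finset.prod_eq_zero (Finset.mem_univ y) ?_
    rw [Pi.single_eq_of_ne (by rintro rfl; exact hxy h), zero_pow hy]
  · refine Finset.prod_eq_zero (Finset.mem_univ x) ?_
    rw [Pi.single_eq_of_ne h, zero_pow hx]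

/-- The shared argument for at least three branches: all but one branch map to the coordinate axes,
and the last one to the diagonal. -/
theorem nonempty_algEquiv_axes {N : ℕ} (R : Subalgebra k (Fin (N + 3) → PowerSeries k))
    (a : Fin (N + 3) → k) (ha : ∀ i, a i ≠ 0)
    (hR : ∀ f, f ∈ R ↔
      (∀ i j, PowerSeries.constantCoeff (f i) = PowerSeries.constantCoeff (f j)) ∧
      ∑ i, a i * PowerSeries.coeff 1 (f i) = 0)
    {ι : Type*} [Fintype ι] (p q : ι → Fin (N + 2) →₀ ℕ)
    (hp : ∀ s, IsMixed (p s)) (hq : ∀ s, IsMixed (q s))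
    (hpq : ∀ s, weight (fun _ => 1) (p s) = weight (fun _ => 1) (q s))
    (I : Ideal (MvPowerSeries (Fin (N + 2)) k))
    (hI : I = Ideal.span (Set.range fun s => monomial (p s) (1 : k) - monomial (q s) 1))
    (hmul : ∀ i j, i ≠ j → Ideal.Quotient.mk I (X i) * Ideal.Quotient.mk I (X j) =
      Ideal.Quotient.mk I (X 0) * Ideal.Quotient.mk I (X 1))
    (hmul₃ : ∀ l, Ideal.Quotient.mk I (X 0) * Ideal.Quotient.mk I (X 1) *
        Ideal.Quotient.mk I (X l) =
      Ideal.Quotient.mk I (X 0) * Ideal.Quotient.mk I (X 1) * Ideal.Quotient.mk I (X 0)) :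
    Nonempty (R ≃ₐ[k] (MvPowerSeries (Fin (N + 2)) k ⧸ I)) := by
  have hw : ∀ i, (fun _ => 1 : Fin (N + 2) → ℕ) i ≠ 0 := fun _ => one_ne_zero
  obtain ⟨s, hs, hs0⟩ : ∃ s : Fin (N + 2) → k,
      (∀ i, a i.castSucc * s i + a (Fin.last _) = 0) ∧ ∀ i, s i ≠ 0 :=
    ⟨fun i => -a (Fin.last _) / a i.castSucc,
      fun i => by field_simp [ha i.castSucc]; ring,
      fun i => div_ne_zero (neg_ne_zero.2 (ha _)) (ha _)⟩
  let α : Fin (N + 3) → Fin (N + 2) → k :=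
    Fin.lastCases (fun _ => 1) fun i => Pi.single i (s i)
  have hαl : α (Fin.last _) = fun _ => 1 := Fin.lastCases_last
  have hαc (i : Fin (N + 2)) : α i.castSucc = Pi.single i (s i) := Fin.lastCases_castSucc ..
  refine nonempty_algEquiv_quotient R a hR (fun _ => 1) hw α ?_ ?_ (Fin.last _)
    (fun j => by rw [hαl]) p q hpq ?_ I hI {d | IsMixed d} ?_ ?_
  · intro j _
    rw [Fin.sum_univ_castSucc, hαl, Finset.sum_eq_single j]
    · simp [hαc, hs]
    · intro i _ hi
      simp [hαc, hi.symm]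
    · simp
  · intro f hf
    obtain ⟨h0, h1⟩ := (hR f).1 hf
    let u : Fin (N + 2) → ℕ → k := fun j M =>
      if M = 0 then 0 else (s j)⁻¹ ^ M * PowerSeries.coeff M (f j.castSucc)
    let v : ℕ → k := fun M =>
      if M = 0 then 0 else PowerSeries.coeff M (f (Fin.last _)) - ∑ j, u j M
    have hv : ∀ M < 2, v M = 0 := by
      intro M hM
      interval_cases M
      · simp [v]
      · have h2 (j : Fin (N + 2)) : a j.castSucc = -(a (Fin.last _) * (s j)⁻¹) := by
          have := hs0 j
          field_simp
          linear_combination hs j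
        rw [Fin.sum_univ_castSucc] at h1
        simp only [h2, neg_mul, mul_assoc, Finset.sum_neg_distrib, ← Finset.mul_sum] at h1
        have h3 : a (Fin.last _) * v 1 = 0 := by
          simp only [v, u, one_ne_zero, if_false, pow_one]
          linear_combination h1
        exact (mul_eq_zero.1 h3).resolve_left (ha _)
    refine ⟨curveSeries (fun _ => 1) (fun _ => 0)
        (fun M => if M = 0 then PowerSeries.constantCoeff (f 0) else 0) +
      ∑ j, curveSeries (fun _ => 1) (fun M => single j M) (u j) +
      curveSeries (fun _ => 1) (fun M => single 0 (M - 1) + single 1 1) v, fun i => ?_⟩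
    ext M
    rw [map_add, map_add, map_add, map_add, map_sum, map_sum, coeff_monomialSubst_curveSeries,
      coeff_monomialSubst_curveSeries]
    · have hu (j : Fin (N + 2)) : PowerSeries.coeff M (monomialSubst (fun _ => 1) hw (α i)
          (curveSeries (fun _ => 1) (fun M => single j M) (u j))) = u j M * α i j ^ M := by
        rw [coeff_monomialSubst_curveSeries _ _ _ _ _ _ fun _ => by simp [weight_single],
          prod_pow_single]
      simp only [hu]
      rcases eq_or_ne M 0 with rfl | hM
      · simp [u, v, h0 0 i]
      refine Fin.lastCases ?_ (fun i => ?_) i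
      · simp [hαl, v, hM]
      · rw [Finset.sum_eq_single i]
        · have hz : v M * ∏ l, α i.castSucc l ^
              (single 0 (M - 1) + single 1 1 : Fin (N + 2) →₀ ℕ) l = 0 := by
            by_cases hM2 : M < 2
            · rw [hv M hM2, zero_mul]
            · rw [hαc, prod_piSingle_pow_of_isMixed, mul_zero]
              refine ⟨0, 1, by simp, ?_, ?_⟩
              · rw [Finsupp.add_apply, single_eq_same]
                omega
              · rw [Finsupp.add_apply, single_eq_same]
                omega
          rw [hz]
          have := hs0 i
          simp [hαc, u, hM]
          field_simp
        · intro j _ hj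
          simp [hαc, hj, hM]
        · simp
    · intro hM
      have : ¬ M < 2 := fun h => hM (hv M h)
      rw [map_add, weight_single, weight_single]
      simp
      omega
    · intro hM
      have : M = 0 := by
        by_contra h
        simp [h] at hM
      simp [this]
  · intro i t
    refine Fin.lastCases ?_ (fun i => ?_) i
    · simp [hαl]
    · rw [hαc, prod_piSingle_pow_of_isMixed (hp t), prod_piSingle_pow_of_isMixed (hq t)]
  · have hnf (d : Fin (N + 2) →₀ ℕ) (hd : IsMixed d) : ∏ i, Ideal.Quotient.mk I (X i) ^ d i =
        Ideal.Quotient.mk I (X 0) * Ideal.Quotient.mk I (X 1) *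
          Ideal.Quotient.mk I (X 0) ^ (weight (fun _ => 1) d - 2) := by
      obtain ⟨i, j, hij, hi, hj⟩ := hd
      obtain ⟨e, rfl⟩ : ∃ e, d = single i 1 + single j 1 + e := by
        refine exists_add_of_le fun l => ?_
        rcases eq_or_ne l i with rfl | hl
        · simp [hij]
          omega
        · rcases eq_or_ne l j with rfl | hl'
          · simp [hl]
            omega
          · simp [hl.symm, hl'.symm]
      have h2 := mul_prod_pow_eq (fun i => Ideal.Quotient.mk I (X i)) (fun _ => 1)
        (Ideal.Quotient.mk I (X 0) * Ideal.Quotient.mk I (X 1)) (Ideal.Quotient.mk I (X 0))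
        (fun l => by rw [pow_one]; exact hmul₃ l) e
      simp only [Finsupp.add_apply, pow_add, Finset.prod_mul_distrib, prod_pow_single, pow_one,
        hmul i j hij, map_add, weight_single, smul_eq_mul, mul_one]
      rw [h2]
      congr 2
      omega
    intro d hd d' hd' h
    rw [hnf d hd, hnf d' hd', h]
  · intro F hF d hd
    by_contra hmix
    obtain ⟨j, e, rfl⟩ := exists_eq_single_of_not_isMixed hmix
    apply hd
    have h := coeff_monomialSubst (fun _ => 1) hw (α j.castSucc) F e
    rw [hF, map_zero, Finset.sum_eq_single (single j e), prod_pow_single, hαc,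
      Pi.single_eq_same] at h
    · exact (mul_eq_zero.1 h.symm).resolve_right (pow_ne_zero _ (hs0 j))
    · intro d' hd' hne
      obtain ⟨l, hl, hl0⟩ : ∃ l, l ≠ j ∧ d' l ≠ 0 := by
        by_contra! hcon
        apply hne
        have h1 := eq_single_of_forall_ne hcon
        have h2 := mem_weightFiber.1 hd'
        rw [h1, weight_single, smul_eq_mul, mul_one] at h2
        rw [h1, h2]
      rw [Finset.prod_eq_zero (Finset.mem_univ l), mul_zero]
      rw [hαc, Pi.single_eq_of_ne hl, zero_pow hl0]
    · intro h1
      exact (h1 (by simp [weight_single])).elim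

theorem nonempty_algEquiv_planar_triple (R : Subalgebra k (Fin 3 → PowerSeries k))
    (a : Fin 3 → k) (ha : ∀ i, a i ≠ 0)
    (hR : ∀ f, f ∈ R ↔
      (∀ i j, PowerSeries.constantCoeff (f i) = PowerSeries.constantCoeff (f j)) ∧
      ∑ i, a i * PowerSeries.coeff 1 (f i) = 0) :
    Nonempty (R ≃ₐ[k] (MvPowerSeries (Fin 2) k ⧸
      Ideal.span {(X 0 : MvPowerSeries (Fin 2) k) ^ 2 * X 1 - X 0 * X 1 ^ 2})) := by
  set I := Ideal.span {(X 0 : MvPowerSeries (Fin 2) k) ^ 2 * X 1 - X 0 * X 1 ^ 2} with hI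
  have hrel : Ideal.Quotient.mk I (X 0) ^ 2 * Ideal.Quotient.mk I (X 1) =
      Ideal.Quotient.mk I (X 0) * Ideal.Quotient.mk I (X 1) ^ 2 := by
    simp only [← map_pow, ← map_mul]
    exact Ideal.Quotient.eq.2 (Ideal.subset_span rfl)
  refine nonempty_algEquiv_axes (N := 0) R a ha hR (fun _ : Unit => single 0 2 + single 1 1)
    (fun _ => single 0 1 + single 1 2) (fun _ => ⟨0, 1, by simp, by simp, by simp⟩)
    (fun _ => ⟨0, 1, by simp, by simp, by simp⟩) (fun _ => by simp [weight_single]) I ?_ ?_ ?_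
  · rw [hI, Set.range_const, X_pow_eq, X_pow_eq, X_def, X_def, monomial_mul_monomial,
      monomial_mul_monomial, mul_one]
  · intro i j hij
    fin_cases i <;> fin_cases j <;> first | exact (hij rfl).elim | simp [mul_comm]
  · intro l
    fin_cases l
    · simp
    · simp only [Fin.mk_one]
      linear_combination -hrel

theorem nonempty_algEquiv_of_four_le {N : ℕ} (R : Subalgebra k (Fin (N + 4) → PowerSeries k))
    (a : Fin (N + 4) → k) (ha : ∀ i, a i ≠ 0)
    (hR : ∀ f, f ∈ R ↔
      (∀ i j, PowerSeries.constantCoeff (f i) = PowerSeries.constantCoeff (f j)) ∧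
      ∑ i, a i * PowerSeries.coeff 1 (f i) = 0) :
    Nonempty (R ≃ₐ[k] (MvPowerSeries (Fin (N + 3)) k ⧸
      Ideal.span {f : MvPowerSeries (Fin (N + 3)) k |
        ∃ h i j : Fin (N + 3), h ≠ i ∧ h ≠ j ∧ i ≠ j ∧ f = X h * (X i - X j)})) := by
  set I := Ideal.span {f : MvPowerSeries (Fin (N + 3)) k |
    ∃ h i j : Fin (N + 3), h ≠ i ∧ h ≠ j ∧ i ≠ j ∧ f = X h * (X i - X j)} with hI
  have hrel (h i j : Fin (N + 3)) (hi : h ≠ i) (hj : h ≠ j) :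
      Ideal.Quotient.mk I (X h) * Ideal.Quotient.mk I (X i) =
        Ideal.Quotient.mk I (X h) * Ideal.Quotient.mk I (X j) := by
    rcases eq_or_ne i j with rfl | hij
    · rfl
    · rw [← map_mul, ← map_mul, Ideal.Quotient.eq]
      exact Ideal.subset_span ⟨h, i, j, hi, hj, hij, (mul_sub ..).symm⟩
  have hmul (i j : Fin (N + 3)) (hij : i ≠ j) :
      Ideal.Quotient.mk I (X i) * Ideal.Quotient.mk I (X j) =
        Ideal.Quotient.mk I (X 0) * Ideal.Quotient.mk I (X 1) := by
    by_cases hi : i = 0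
    · subst hi
      exact hrel 0 j 1 hij (by simp)
    · rw [hrel i j 0 hij hi, mul_comm, hrel 0 i 1 (Ne.symm hi) (by simp)]
  have h20 : (⟨2, by omega⟩ : Fin (N + 3)) ≠ 0 := by simp [Fin.ext_iff]
  have h21 : (⟨2, by omega⟩ : Fin (N + 3)) ≠ 1 := by simp [Fin.ext_iff]
  let ι := {t : Fin (N + 3) × Fin (N + 3) × Fin (N + 3) //
    t.1 ≠ t.2.1 ∧ t.1 ≠ t.2.2 ∧ t.2.1 ≠ t.2.2}
  refine nonempty_algEquiv_axes (N := N + 1) R a ha hR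
    (fun t : ι => single t.1.1 1 + single t.1.2.1 1)
    (fun t => single t.1.1 1 + single t.1.2.2 1)
    (fun t => ⟨t.1.1, t.1.2.1, t.2.1, by simp, by simp⟩)
    (fun t => ⟨t.1.1, t.1.2.2, t.2.2.1, by simp, by simp⟩)
    (fun _ => by simp [weight_single]) I ?_ hmul ?_
  · rw [hI]
    congr 1
    ext f
    constructor
    · rintro ⟨h, i, j, hi, hj, hij, rfl⟩
      refine ⟨⟨(h, i, j), hi, hj, hij⟩, ?_⟩
      simp only [X_def, mul_sub, monomial_mul_monomial, mul_one]
    · rintro ⟨⟨⟨h, i, j⟩, hi, hj, hij⟩, rfl⟩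
      refine ⟨h, i, j, hi, hj, hij, ?_⟩
      simp only [X_def, mul_sub, monomial_mul_monomial, mul_one]
  · intro l
    by_cases hl : l = 1
    · subst hl
      have h1 := hmul 0 _ h20.symm
      have h2 := hmul _ 1 h21
      linear_combination -Ideal.Quotient.mk I (X 1) * h1 + Ideal.Quotient.mk I (X 0) * h2
    · rw [mul_assoc, hrel 1 l 0 (Ne.symm hl) (by simp), ← mul_assoc]

end Parametrization

end EllipticMFold

/-- A reduced complete local one-dimensional Gorenstein `k`-algebra with `m`
branches and genus one (`δ = dim_k(R̃/R) = m`, and `dim_k(R/I) = dim_k(R̃/R)`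
for the conductor `I`) is isomorphic to the complete local ring of the elliptic
`m`-fold point. -/
theorem stmt8 (k : Type) [Field k] [IsAlgClosed k] (m : ℕ) (hm : 1 ≤ m)
    (R : Subalgebra k (Fin m → PowerSeries k))
    (hred : IsReduced R)
    (hloc : IsLocalRing R)
    (hdim : ringKrullDim R = 1)
    (hnorm : integralClosure R (Fin m → PowerSeries k) = ⊤)
    (hbr : Function.Injective fun i : Fin m =>
      RingHom.ker ((Pi.evalRingHom (fun _ => PowerSeries k) i).comp
        (Subalgebra.val R).toRingHom))
    (hδ : Module.finrank k
        ((Fin m → PowerSeries k) ⧸ Subalgebra.toSubmodule R) = m)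
    (hGor : Module.finrank k (R ⧸ conductorIdeal k m R) =
        Module.finrank k
          ((Fin m → PowerSeries k) ⧸ Subalgebra.toSubmodule R)) :
    IsEllipticMFold k m R := by
  obtain ⟨a, ha0, hR⟩ := EllipticMFold.exists_mem_iff hm R hloc hδ
  have ha := EllipticMFold.forall_ne_zero_of_finrank_conductorIdeal R a ha0 hR (hGor.trans hδ)
  refine ⟨?_, ?_, ?_, fun hm4 => ?_⟩
  · rintro rfl
    exact EllipticMFold.nonempty_algEquiv_cusp R a ha hR
  · rintro rfl
    exact EllipticMFold.nonempty_algEquiv_tacnode R a ha hR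
  · rintro rfl
    exact EllipticMFold.nonempty_algEquiv_planar_triple R a ha hR
  · obtain ⟨N, rfl⟩ := Nat.exists_eq_add_of_le' hm4
    exact EllipticMFold.nonempty_algEquiv_of_four_le R a ha hR
end
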